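/- arXiv:1706.08645 — 2 statements merged into one kernel-verified Lean document; each statement's English description precedes it below -/
import Mathlib

section
/- Let n ≥ 5 be an integer and, for an integer s ≥ 1, set δ_s = (s(s+1)/2)·C(n+s−1, s+2). Then for every integer m with 6 ≤ m ≤ n+1, δ_{m−2} − C(n+m−4, m−3)·δ_1 + n·δ_{m−3} − 2·C(n+m−4, m−3)·C(n+1, 3) + C(n+m−3, m−2)·C(n+1, 2) − C(n+m−1, m) = 0. -/
/-- `δ_s = (s(s+1)/2)·C(n+s−1, s+2)`. -/
def deltaIK (n s : ℕ) : ℤ := (s * (s + 1) / 2 : ℕ) * ((n + s - 1).choose (s + 2))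

/-- Consecutive binomial coefficients in a row, with the cast written additively. -/
theorem cast_choose_add_succ (N k j : ℕ) :
    ((N + k).choose (k + j + 1) : ℚ) * (k + j + 1) = (N + k).choose (k + j) * (N - j) := by
  rcases le_or_gt j N with h | h
  · have := Nat.choose_succ_right_eq (N + k) (k + j)
    rw [show N + k - (k + j) = N - j by omega] at this
    have h2 : (((N + k).choose (k + j + 1) * (k + j + 1) : ℕ) : ℚ)
        = ((N + k).choose (k + j) * (N - j) : ℕ) := by rw [this]
    push_cast [Nat.cast_sub h] at h2
    exact h2
  · rw [Nat.choose_eq_zero_of_lt (show N + k < k + j + 1 by omega),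
      Nat.choose_eq_zero_of_lt (show N + k < k + j by omega)]
    simp

theorem cast_deltaIK (n s : ℕ) :
    (deltaIK n s : ℚ) = s * (s + 1) / 2 * (n + s - 1).choose (s + 2) := by
  unfold deltaIK
  rw [Int.cast_mul, Int.cast_natCast, Int.cast_natCast,
    Nat.cast_div (Nat.even_mul_succ_self s).two_dvd (by norm_num)]
  push_cast
  ring

theorem cast_succ_succ_choose_three (N : ℕ) :
    ((N + 2).choose 3 : ℚ) = (N + 2) * (N + 1) * N / 6 := by
  have h := cast_choose_add_succ N 2 0
  have h2 : ((N + 2).choose 2 : ℚ) = (N + 2) * (N + 1) / 2 := by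
    rw [Nat.cast_choose_two]; push_cast; ring
  norm_num [h2] at h
  linarith

theorem cast_succ_choose_three (N : ℕ) :
    ((N + 1).choose 3 : ℚ) = (N + 1) * N * (N - 1) / 6 := by
  have h : ((N + 2).choose 3 : ℚ) = (N + 1).choose 2 + (N + 1).choose 3 := by
    exact_mod_cast Nat.choose_succ_succ' (N + 1) 2
  rw [cast_succ_succ_choose_three, Nat.cast_choose_two] at h
  push_cast at h
  linear_combination -h

/-- For `n ≥ 5` and `6 ≤ m ≤ n+1`,
`δ_{m−2} − C(n+m−4, m−3) δ_1 + n δ_{m−3} − 2 C(n+m−4, m−3) C(n+1, 3)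
 + C(n+m−3, m−2) C(n+1, 2) − C(n+m−1, m) = 0`. -/
theorem stmt_16 (n : ℕ) (hn : 5 ≤ n) (m : ℕ) (hm1 : 6 ≤ m) (hm2 : m ≤ n + 1) :
    deltaIK n (m - 2) - ((n + m - 4).choose (m - 3)) * deltaIK n 1 + n * deltaIK n (m - 3)
      - 2 * ((n + m - 4).choose (m - 3)) * ((n + 1).choose 3)
      + ((n + m - 3).choose (m - 2)) * ((n + 1).choose 2)
      - ((n + m - 1).choose m) = 0 := by
  obtain ⟨k, rfl⟩ : ∃ k, m = k + 3 := ⟨m - 3, by omega⟩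
  obtain ⟨N, rfl⟩ : ∃ N, n = N + 1 := ⟨n - 1, by omega⟩
  rw [← Int.cast_inj (α := ℚ)]
  push_cast [cast_deltaIK]
  rw [show N + 1 + (k + 1) - 1 = N + k + 1 by omega, show N + 1 + k - 1 = N + k by omega,
    show N + 1 + (k + 3) - 4 = N + k by omega, show N + 1 + (k + 3) - 3 = N + k + 1 by omega,
    show N + 1 + (k + 3) - 1 = N + k + 3 by omega,
    show k + 1 + 2 = k + 3 by omega]
  have h1 := cast_choose_add_succ N k 0
  have h2 := cast_choose_add_succ N k 1
  have h3 := cast_choose_add_succ N k 2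
  simp only [add_assoc, Nat.reduceAdd, add_zero] at h1 h2 h3
  push_cast at h1 h2 h3
  have e1 : ((N + k).choose (k + 1) : ℚ) = (N + k).choose k * N / (k + 1) := by
    field_simp; linear_combination h1
  have e2 : ((N + k).choose (k + 2) : ℚ)
      = (N + k).choose k * N * (N - 1) / ((k + 1) * (k + 2)) := by
    rw [e1] at h2
    field_simp at h2 ⊢; linear_combination h2
  have e3 : ((N + k).choose (k + 3) : ℚ)
      = (N + k).choose k * N * (N - 1) * (N - 2) / ((k + 1) * (k + 2) * (k + 3)) := by
    rw [e2] at h3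
    field_simp at h3 ⊢; linear_combination h3
  simp only [Nat.choose_succ_succ' (N + k + 2), Nat.choose_succ_succ' (N + k + 1),
    Nat.choose_succ_succ' (N + k)]
  push_cast [cast_succ_choose_three, cast_succ_succ_choose_three,
    Nat.cast_choose_two, e1, e2, e3]
  field_simp
  ring
end

section
/- Let k be an algebraically closed field of characteristic zero, let n ≥ 2 and d ≥ 2 be integers, and let f_1, …, f_n ∈ k[x_1, …, x_n] be homogeneous polynomials of degree d whose only common zero in k^n is the origin. Then for every i with 1 ≤ i ≤ n, the product x_i · jac(f) lies in the ideal (f_1, …, f_n), where jac(f) = det(∂f_i/∂x_j) is the Jacobian determinant. (Thus the image of jac(f) in k[x_1, …, x_n]/(f_1, …, f_n) lies in the socle of this local Artinian algebra.) -/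
/-- For homogeneous `f_1, …, f_n` of degree `d ≥ 2` over an algebraically closed field of
characteristic zero whose only common zero is the origin, each product `x_i · jac(f)` of a
variable with the Jacobian determinant lies in the ideal `(f_1, …, f_n)`. -/
theorem stmt_18 {k : Type*} [Field k] [IsAlgClosed k] [CharZero k]
    (n d : ℕ) (hn : 2 ≤ n) (hd : 2 ≤ d)
    (f : Fin n → MvPolynomial (Fin n) k)
    (hf : ∀ i, (f i).IsHomogeneous d)
    (hzero : ∀ x : Fin n → k, (∀ i, MvPolynomial.eval x (f i) = 0) → x = 0) :
    ∀ l : Fin n,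
      MvPolynomial.X l * (Matrix.of fun i j => MvPolynomial.pderiv j (f i)).det
        ∈ Ideal.span (Set.range f) := by
  intro l
  set J : Matrix (Fin n) (Fin n) (MvPolynomial (Fin n) k) :=
    Matrix.of fun i j => MvPolynomial.pderiv j (f i)
  have euler : J.mulVec MvPolynomial.X = d • f := by
    funext i
    simpa [J, Matrix.mulVec, dotProduct, mul_comm] using (hf i).sum_X_mul_pderiv
  have cramer : J.det • MvPolynomial.X = J.adjugate.mulVec (d • f) := by
    rw [← euler, Matrix.mulVec_mulVec, Matrix.adjugate_mul, Matrix.smul_mulVec, Matrix.one_mulVec]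
  have hl : MvPolynomial.X l * J.det = ∑ i, J.adjugate l i * (d • f i) := by
    simpa [Matrix.mulVec, dotProduct, mul_comm] using congrFun cramer l
  rw [hl]
  exact Ideal.sum_mem _ fun i _ => Ideal.mul_mem_left _ _ <|
    nsmul_mem (Ideal.subset_span (Set.mem_range_self i)) d
end
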